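/- For every real number r and all integers d and i, ∑_{d ∈ ℤ} w_r(d) · (d · i) = r · i; that is, every fractional dilated sampling offset r·i along the dilated axis is the w_r-weighted linear interpolation of the corresponding integer dilated sampling offsets d·i. -/

import Mathlib

/-- The interpolation weight of the adaptive fractional dilated convolution. -/
noncomputable def afdcWeight (r : ℝ) (d : ℤ) : ℝ :=
  if 0 ≤ (d : ℝ) - r ∧ (d : ℝ) - r < 1 then r - ((d : ℝ) - 1)
  else if -1 < (d : ℝ) - r ∧ (d : ℝ) - r < 0 then ((d : ℝ) + 1) - r
  else 0

theorem afdcWeight_floor (r : ℝ) : afdcWeight r ⌊r⌋ = ⌊r⌋ + 1 - r := by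
  have h₁ := Int.floor_le r
  have h₂ := Int.lt_floor_add_one r
  unfold afdcWeight
  split_ifs with h h'
  · linarith [h.1]
  · rfl
  · exact absurd ⟨by linarith, by by_contra hn; exact h ⟨by linarith, by linarith⟩⟩ h'

theorem afdcWeight_floor_add_one (r : ℝ) : afdcWeight r (⌊r⌋ + 1) = r - ⌊r⌋ := by
  have h₁ := Int.floor_le r
  have h₂ := Int.lt_floor_add_one r
  unfold afdcWeight
  push_cast
  split_ifs with h h'
  · ring
  · linarith [h'.2]
  · by_contra hn
    exact h ⟨by linarith, lt_of_le_of_ne (by linarith) fun he => hn (by linarith)⟩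

theorem support_afdcWeight_subset (r : ℝ) :
    Function.support (afdcWeight r) ⊆ {⌊r⌋, ⌊r⌋ + 1} := by
  intro d hd
  have h₁ := Int.floor_le r
  have h₂ := Int.lt_floor_add_one r
  have hdist : -1 < (d : ℝ) - r ∧ (d : ℝ) - r < 1 := by
    by_contra hn
    refine hd ?_
    unfold afdcWeight
    rw [if_neg fun h => hn ⟨by linarith [h.1], h.2⟩,
      if_neg fun h => hn ⟨h.1, by linarith [h.2]⟩]
  have hlo : ⌊r⌋ - 1 < d := by
    rw [← Int.cast_lt (R := ℝ)]
    push_cast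
    linarith [hdist.1]
  have hhi : d < ⌊r⌋ + 2 := by
    rw [← Int.cast_lt (R := ℝ)]
    push_cast
    linarith [hdist.2]
  rw [Set.mem_insert_iff, Set.mem_singleton_iff]
  omega

theorem afdcWeight_interpolates_offsets (r : ℝ) (i : ℤ) :
    ∑ᶠ d : ℤ, afdcWeight r d * ((d : ℝ) * (i : ℝ)) = r * (i : ℝ) := by
  rw [finsum_eq_sum_of_support_subset (s := {⌊r⌋, ⌊r⌋ + 1}) _ <| by
      rw [Finset.coe_insert, Finset.coe_singleton]
      exact (Function.support_mul_subset_left _ _).trans (support_afdcWeight_subset r),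
    Finset.sum_pair (by omega), afdcWeight_floor, afdcWeight_floor_add_one]
  push_cast
  ring
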